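/- arXiv:2105.11324 — 4 statements merged into one kernel-verified Lean document; each statement's English description precedes it below -/
import Mathlib

section
/- Let n ≥ 2 be an integer, c > 0, and let ℓ : ℕ → ℕ satisfy ℓ(m) ≤ 2(1+m)^{n−2} for all m. Set I := {(m,k,j) ∈ ℕ³ : 1 ≤ j ≤ ℓ(m)} and for i₁ = (m₁,k₁,j₁), i₂ = (m₂,k₂,j₂) in I write σ(i₁,i₂) := max(m₁+k₁, m₂+k₂). There exist constants K > 0 and K' > 1 (depending only on n and c) such that: for every C₁ ≥ 1 and every δ with 0 < δ < C₁, there is a finite set Y of functions I × I → ℝ with the following two properties: (i) for every a : I × I → ℝ satisfying |a(i₁,i₂)| ≤ C₁ e^{−c·σ(i₁,i₂)} for all i₁,i₂, there exists b ∈ Y with sup_{i₁,i₂} (1+σ(i₁,i₂))^{n+2} |a(i₁,i₂) − b(i₁,i₂)| ≤ δ; and (ii) log |Y| ≤ K · (log(K' C₁ / δ))^{2n+1}. -/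
/-- The index set `I = {(m,k,j) ∈ ℕ³ : 1 ≤ j ≤ ℓ(m)}`. -/
def NetIdx (ℓ : ℕ → ℕ) : Type :=
  {p : ℕ × ℕ × ℕ // 1 ≤ p.2.2 ∧ p.2.2 ≤ ℓ p.1}

/-- `σ(i₁,i₂) = max(m₁+k₁, m₂+k₂)`. -/
def netSigma {ℓ : ℕ → ℕ} (i₁ i₂ : NetIdx ℓ) : ℕ :=
  max (i₁.1.1 + i₁.1.2.1) (i₂.1.1 + i₂.1.2.1)

/-- A box of radius `B` on a finite set `S` of coordinates has a finite `h`-net, in the sup norm,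
of functions supported on `S`, obtained by rounding to multiples of `h`. -/
lemma exists_finset_rounding_net {α : Type*} (S : Set α) [Finite S] {h B : ℝ} (hh : 0 < h)
    (hB : 0 ≤ B) :
    ∃ Y : Finset (α → ℝ), Y.Nonempty ∧ (Y.card : ℝ) ≤ (2 * (B / h) + 2) ^ Nat.card S ∧
      ∀ a : α → ℝ, (∀ i ∈ S, |a i| ≤ B) →
        ∃ b ∈ Y, (∀ i ∈ S, |a i - b i| ≤ h) ∧ ∀ i ∉ S, b i = 0 := by
  classical
  have := Fintype.ofFinite S
  set T : Finset ℤ := Finset.Icc ⌊-(B / h)⌋ ⌊B / h⌋ with hT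
  have hle : -(B / h) ≤ B / h := by
    have : 0 ≤ B / h := by positivity
    linarith
  have hTcard : (T.card : ℝ) ≤ 2 * (B / h) + 2 := by
    have h0 : (0 : ℤ) ≤ ⌊B / h⌋ + 1 - ⌊-(B / h)⌋ := by
      have := Int.floor_le_floor hle
      linarith
    have h1 : ((T.card : ℤ) : ℝ) = ((⌊B / h⌋ + 1 - ⌊-(B / h)⌋ : ℤ) : ℝ) := by
      rw [hT, Int.card_Icc, Int.toNat_of_nonneg h0]
    push_cast at h1
    have h2 := Int.floor_le (B / h)
    have h3 := Int.lt_floor_add_one (-(B / h))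
    linarith
  have hmem : ∀ x : ℝ, |x| ≤ B → ⌊x / h⌋ ∈ T := by
    intro x hx
    rw [abs_le] at hx
    rw [hT, Finset.mem_Icc]
    refine ⟨Int.floor_le_floor ?_, Int.floor_le_floor ?_⟩
    · rw [← neg_div]
      exact div_le_div_of_nonneg_right hx.1 hh.le
    · exact div_le_div_of_nonneg_right hx.2 hh.le
  let f : (S → T) → α → ℝ := fun g i => if hi : i ∈ S then h * ((g ⟨i, hi⟩ : ℤ) : ℝ) else 0
  have hne : Nonempty (S → T) := ⟨fun _ => ⟨_, hmem 0 (by simpa using hB)⟩⟩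
  refine ⟨Finset.univ.image f, Finset.univ_nonempty.image f, ?_, ?_⟩
  · calc ((Finset.univ.image f).card : ℝ)
        ≤ ((Finset.univ : Finset (S → T)).card : ℝ) := by exact_mod_cast Finset.card_image_le
      _ = (T.card : ℝ) ^ Nat.card S := by
          simp [Nat.card_eq_fintype_card]
      _ ≤ _ := by gcongr
  · intro a ha
    refine ⟨f fun i => ⟨⌊a i / h⌋, hmem _ (ha i i.2)⟩, Finset.mem_image_of_mem _ (Finset.mem_univ _),
      fun i hi => ?_, fun i hi => ?_⟩
    · simp only [f, hi, dite_true]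
      have h1 := Int.floor_le (a i / h)
      have h2 := Int.lt_floor_add_one (a i / h)
      rw [le_div_iff₀ hh] at h1
      rw [div_lt_iff₀ hh] at h2
      rw [abs_le]
      constructor <;> linarith
    · simp [f, hi]

lemma NetIdx.exists_injective_fin {ℓ : ℕ → ℕ} {d : ℕ} (hℓ : ∀ m, ℓ m ≤ 2 * (1 + m) ^ d) (N : ℕ) :
    ∃ f : {i : NetIdx ℓ // i.1.1 + i.1.2.1 < N} → Fin N × Fin N × Fin (2 * N ^ d),
      Function.Injective f := by
  have hj : ∀ i : {i : NetIdx ℓ // i.1.1 + i.1.2.1 < N}, i.1.1.2.2 - 1 < 2 * N ^ d := by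
    rintro ⟨⟨⟨m, k, j⟩, h1, h2⟩, h3⟩
    dsimp only at h1 h2 h3 ⊢
    have h4 : (1 + m) ^ d ≤ N ^ d := Nat.pow_le_pow_left (by omega) d
    have h5 := hℓ m
    omega
  refine ⟨fun i => (⟨i.1.1.1, by have := i.2; omega⟩, ⟨i.1.1.2.1, by have := i.2; omega⟩,
    ⟨i.1.1.2.2 - 1, hj i⟩), ?_⟩
  rintro ⟨⟨⟨m, k, j⟩, h1, h2⟩, h3⟩ ⟨⟨⟨m', k', j'⟩, h1', h2'⟩, h3'⟩ h
  simp only [Prod.mk.injEq, Fin.mk.injEq] at h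
  dsimp only at h1 h1'
  obtain ⟨rfl, rfl, h⟩ := h
  obtain rfl : j = j' := by omega
  rfl

/-- The number of index pairs with `σ < N` is at most `4 N ^ (2 d + 4)` when
`ℓ(m) ≤ 2 (1 + m) ^ d`. -/
lemma netSigma_lt_finite_card_le {ℓ : ℕ → ℕ} {d : ℕ} (hℓ : ∀ m, ℓ m ≤ 2 * (1 + m) ^ d) (N : ℕ) :
    Finite {p : NetIdx ℓ × NetIdx ℓ | netSigma p.1 p.2 < N} ∧
      Nat.card {p : NetIdx ℓ × NetIdx ℓ | netSigma p.1 p.2 < N} ≤ 4 * N ^ (2 * d + 4) := by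
  obtain ⟨f, hf⟩ := NetIdx.exists_injective_fin hℓ N
  let g : {p : NetIdx ℓ × NetIdx ℓ | netSigma p.1 p.2 < N} →
      (Fin N × Fin N × Fin (2 * N ^ d)) × (Fin N × Fin N × Fin (2 * N ^ d)) := fun p =>
    (f ⟨p.1.1, (le_max_left _ _).trans_lt p.2⟩, f ⟨p.1.2, (le_max_right _ _).trans_lt p.2⟩)
  have hg : Function.Injective g := by
    rintro ⟨⟨p, q⟩, hp⟩ ⟨⟨p', q'⟩, hp'⟩ h
    simp only [g, Prod.mk.injEq, hf.eq_iff, Subtype.mk.injEq] at h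
    obtain ⟨rfl, rfl⟩ := h
    rfl
  refine ⟨Finite.of_injective g hg, (Nat.card_le_card_of_injective g hg).trans_eq ?_⟩
  simp only [Nat.card_prod, Nat.card_fin]
  ring

/-- Exponential decay absorbs polynomial weights, at the cost of half of the rate. -/
lemma one_add_pow_mul_exp_neg_le {c x : ℝ} (hc : 0 < c) (hx : 0 ≤ x) (p : ℕ) :
    (1 + x) ^ p * Real.exp (-c * x) ≤
      p.factorial * Real.exp (c / 2) * (2 / c) ^ p * Real.exp (-(c / 2 * x)) := by
  have h := Real.pow_div_factorial_le_exp (c / 2 * (1 + x)) (by positivity) p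
  rw [div_le_iff₀ (by positivity), mul_pow] at h
  calc (1 + x) ^ p * Real.exp (-c * x)
      = ((c / 2) ^ p * (1 + x) ^ p) * ((2 / c) ^ p * Real.exp (-c * x)) := by
        have : (c / 2) ^ p * (2 / c) ^ p = 1 := by
          rw [← mul_pow, div_mul_div_cancel₀ two_ne_zero, div_self hc.ne', one_pow]
        linear_combination (-(1 + x) ^ p * Real.exp (-c * x)) * this
    _ ≤ (Real.exp (c / 2 * (1 + x)) * p.factorial) * ((2 / c) ^ p * Real.exp (-c * x)) := by
        gcongr
    _ = p.factorial * (2 / c) ^ p * (Real.exp (c / 2 * (1 + x)) * Real.exp (-c * x)) := by ring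
    _ = p.factorial * (2 / c) ^ p * (Real.exp (c / 2) * Real.exp (-(c / 2 * x))) := by
        rw [← Real.exp_add, ← Real.exp_add]
        ring_nf
    _ = _ := by ring

/-- δ-net (metric entropy) estimate for the set of tensors indexed by
`I × I`, `I = {(m,k,j) : 1 ≤ j ≤ ℓ(m)}` with `ℓ(m) ≤ 2(1+m)^{n-2}`, which decay like
`C₁ e^{-c σ}`: there is a finite δ-net `Y` for the weighted sup norm
`sup (1+σ)^{n+2}|a - b|`, with `log |Y| ≤ K (log (K' C₁/δ))^{2n+1}`, where the constants
`K > 0`, `K' > 1` depend only on `n` and `c`. -/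
theorem delta_net_for_decaying_tensors (n : ℕ) (hn : 2 ≤ n) (c : ℝ) (hc : 0 < c) :
    ∃ K K' : ℝ, 0 < K ∧ 1 < K' ∧
      ∀ ℓ : ℕ → ℕ, (∀ m, ℓ m ≤ 2 * (1 + m) ^ (n - 2)) →
        ∀ C₁ δ : ℝ, 1 ≤ C₁ → 0 < δ → δ < C₁ →
          ∃ Y : Finset (NetIdx ℓ → NetIdx ℓ → ℝ),
            (∀ a : NetIdx ℓ → NetIdx ℓ → ℝ,
              (∀ i₁ i₂, |a i₁ i₂| ≤ C₁ * Real.exp (-c * (netSigma i₁ i₂ : ℕ))) →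
              ∃ b ∈ Y, ∀ i₁ i₂,
                ((1 : ℝ) + (netSigma i₁ i₂ : ℕ)) ^ (n + 2) * |a i₁ i₂ - b i₁ i₂| ≤ δ) ∧
            Real.log Y.card ≤ K * (Real.log (K' * C₁ / δ)) ^ (2 * n + 1) := by
  obtain ⟨d, rfl⟩ := Nat.exists_eq_add_of_le' hn
  set p := d + 2 + 2 with hp
  set M : ℝ := p.factorial * Real.exp (c / 2) * (2 / c) ^ p with hM
  have hM0 : 0 < M := by positivity
  set A : ℝ := 2 / c + 1 with hA
  have hA0 : 0 < A := by positivity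
  have hK4 : (4 : ℝ) ≤ M + 4 := by linarith
  refine ⟨4 * A ^ (2 * d + 4) * (1 + p * A), M + 4, by positivity, by linarith, ?_⟩
  intro ℓ hℓ C₁ δ hC hδ hδC
  have hC0 : 0 < C₁ := by linarith
  set L := Real.log ((M + 4) * C₁ / δ) with hL
  have hratio : 1 ≤ C₁ / δ := (one_le_div hδ).2 hδC.le
  have hargpos : 0 < (M + 4) * C₁ / δ := by positivity
  have hL1 : 1 ≤ L := by
    rw [hL, Real.le_log_iff_exp_le hargpos, mul_div_assoc]
    have := Real.exp_one_lt_d9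
    nlinarith
  set N := ⌈2 / c * L⌉₊ with hN
  have hNge : 2 / c * L ≤ N := Nat.le_ceil _
  have hNle : (N : ℝ) ≤ A * L := by
    have := Nat.ceil_lt_add_one (a := 2 / c * L) (by positivity)
    rw [hA, add_mul]
    linarith
  obtain ⟨hfin, hcard⟩ := netSigma_lt_finite_card_le (d := d) hℓ N
  set h : ℝ := δ / (1 + N) ^ p with hh
  have hh0 : 0 < h := by positivity
  have hBh : C₁ / h = C₁ / δ * (1 + N) ^ p := by
    rw [hh]
    field_simp
  obtain ⟨Y, hYne, hYcard, hY⟩ := exists_finset_rounding_net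
    {q : NetIdx ℓ × NetIdx ℓ | netSigma q.1 q.2 < N} hh0 hC0.le
  refine ⟨Y.map (Equiv.curry _ _ _).toEmbedding, ?_, ?_⟩
  · intro a ha
    obtain ⟨b, hbY, hb, hb0⟩ := hY (fun q => a q.1 q.2) fun q _ => (ha q.1 q.2).trans
      (mul_le_of_le_one_right hC0.le (Real.exp_le_one_iff.2
        (by have : 0 ≤ c * (netSigma q.1 q.2 : ℝ) := by positivity
            linarith)))
    refine ⟨_, Finset.mem_map_of_mem _ hbY, fun i₁ i₂ => ?_⟩
    change _ * |a i₁ i₂ - b (i₁, i₂)| ≤ δ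
    by_cases hi : netSigma i₁ i₂ < N
    · have h1 : |a i₁ i₂ - b (i₁, i₂)| ≤ h := hb (i₁, i₂) hi
      have h2 : (netSigma i₁ i₂ : ℝ) ≤ N := by exact_mod_cast hi.le
      calc ((1 : ℝ) + (netSigma i₁ i₂ : ℕ)) ^ p * |a i₁ i₂ - b (i₁, i₂)|
          ≤ (1 + N) ^ p * h := by gcongr
        _ = δ := by
          rw [hh]
          field_simp
    · rw [hb0 (i₁, i₂) hi, sub_zero]
      have h2 : (N : ℝ) ≤ netSigma i₁ i₂ := by exact_mod_cast not_lt.1 hi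
      have h3 : L ≤ c / 2 * netSigma i₁ i₂ := by
        have := hNge.trans h2
        rw [div_mul_eq_mul_div, div_le_iff₀ hc] at this
        linarith
      have h4 : Real.exp (-(c / 2 * netSigma i₁ i₂)) ≤ δ / ((M + 4) * C₁) := by
        calc _ ≤ Real.exp (-L) := Real.exp_le_exp.2 (by linarith)
          _ = _ := by rw [Real.exp_neg, hL, Real.exp_log hargpos, inv_div]
      calc ((1 : ℝ) + (netSigma i₁ i₂ : ℕ)) ^ p * |a i₁ i₂|
          ≤ (1 + (netSigma i₁ i₂ : ℕ)) ^ p * (C₁ * Real.exp (-c * (netSigma i₁ i₂ : ℕ))) := by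
            gcongr
            exact ha i₁ i₂
        _ = C₁ * ((1 + (netSigma i₁ i₂ : ℕ)) ^ p * Real.exp (-c * (netSigma i₁ i₂ : ℕ))) := by
            ring
        _ ≤ C₁ * (M * Real.exp (-(c / 2 * netSigma i₁ i₂))) := by
            gcongr C₁ * ?_
            exact one_add_pow_mul_exp_neg_le hc (Nat.cast_nonneg _) p
        _ ≤ C₁ * ((M + 4) * (δ / ((M + 4) * C₁))) := by
            gcongr
            linarith
        _ = δ := by field_simp
  · rw [Finset.card_map]
    have hpow1 : (1 : ℝ) ≤ (1 + N) ^ p := one_le_pow₀ (by simp)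
    have hlog : Real.log (2 * (C₁ / h) + 2) ≤ (1 + p * A) * L := by
      have h1 : 2 * (C₁ / h) + 2 ≤ ((M + 4) * C₁ / δ) * (1 + N) ^ p := by
        rw [hBh, mul_div_assoc, mul_assoc]
        have : 1 ≤ C₁ / δ * (1 + N : ℝ) ^ p := one_le_mul_of_one_le_of_one_le hratio hpow1
        nlinarith
      calc Real.log (2 * (C₁ / h) + 2)
          ≤ Real.log (((M + 4) * C₁ / δ) * (1 + N) ^ p) :=
            Real.log_le_log (by positivity) h1
        _ = L + p * Real.log (1 + N) := by
            rw [Real.log_mul hargpos.ne' (by positivity), Real.log_pow]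
        _ ≤ L + p * (A * L) := by
            have := Real.log_le_sub_one_of_pos (show (0 : ℝ) < 1 + N by positivity)
            gcongr
            linarith
        _ = _ := by ring
    have hlog0 : 0 ≤ Real.log (2 * (C₁ / h) + 2) :=
      Real.log_nonneg (by have : 0 < C₁ / h := by positivity
                          linarith)
    calc Real.log Y.card
        ≤ Real.log ((2 * (C₁ / h) + 2) ^
            Nat.card {q : NetIdx ℓ × NetIdx ℓ | netSigma q.1 q.2 < N}) :=
          Real.log_le_log (by exact_mod_cast hYne.card_pos) hYcard
      _ = Nat.card {q : NetIdx ℓ × NetIdx ℓ | netSigma q.1 q.2 < N} *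
            Real.log (2 * (C₁ / h) + 2) := Real.log_pow _ _
      _ ≤ (4 * N ^ (2 * d + 4) : ℕ) * Real.log (2 * (C₁ / h) + 2) := by gcongr
      _ ≤ (4 * (A * L) ^ (2 * d + 4)) * ((1 + p * A) * L) := by
          push_cast
          gcongr
      _ = _ := by ring_nf
end

section
/- Let n ≥ 1 be an integer, let α ∈ (0,1], and fix r₀ ∈ (0,1). There exists a constant μ = μ(n,α) > 0 such that for every β > 0 and every ε ∈ (0, μβ) there is a finite set Z of continuous functions q : ℝⁿ → ℝ with the following properties: (i) every q ∈ Z satisfies q ≥ 0 everywhere, q(x) = 0 for |x| ≥ r₀, sup_x |q(x)| ≤ ε, and sup_x |q(x)| + sup_{x≠y} |q(x)−q(y)|/|x−y|^α ≤ β; (ii) any two distinct q₁, q₂ ∈ Z satisfy sup_x |q₁(x) − q₂(x)| ≥ ε; and (iii) log |Z| ≥ 2^{−(n+1)} (μβ/ε)^{n/α}. -/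
open Metric in
/-- The function of height `ε` which vanishes outside the balls of radius `ρ` around the points
of `s` and grows linearly, with slope `ε / ρ`, with the distance to the complement of their union. -/
noncomputable def coneBump {X : Type*} [PseudoMetricSpace X] (ε ρ : ℝ) (s : Set X) (x : X) : ℝ :=
  min ε (ε / ρ * infDist x (⋃ p ∈ s, ball p ρ)ᶜ)

namespace coneBump

open Metric

variable {X : Type*} [PseudoMetricSpace X] {ε ρ : ℝ} {s : Set X}

lemma nonneg (hε : 0 ≤ ε) (hρ : 0 ≤ ρ) (x : X) : 0 ≤ coneBump ε ρ s x :=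
  le_min hε (mul_nonneg (div_nonneg hε hρ) infDist_nonneg)

lemma le_height (x : X) : coneBump ε ρ s x ≤ ε := min_le_left _ _

lemma continuous : Continuous (coneBump ε ρ s) :=
  continuous_const.min (continuous_const.mul (continuous_infDist_pt _))

lemma eq_zero (hε : 0 ≤ ε) {x : X} (hx : ∀ p ∈ s, ρ ≤ dist x p) : coneBump ε ρ s x = 0 := by
  have hmem : x ∈ (⋃ p ∈ s, ball p ρ)ᶜ := by simpa using hx
  rw [coneBump, infDist_zero_of_mem hmem, mul_zero, min_eq_right hε]

lemma eq_height (hε : 0 ≤ ε) (hρ : 0 < ρ) (hs : (⋃ p ∈ s, ball p ρ)ᶜ.Nonempty) {p : X}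
    (hp : p ∈ s) : coneBump ε ρ s p = ε := by
  refine min_eq_left ?_
  have h : ρ ≤ infDist p (⋃ p ∈ s, ball p ρ)ᶜ := by
    refine (le_infDist hs).2 fun y hy ↦ ?_
    simp only [Set.mem_compl_iff, Set.mem_iUnion, mem_ball, not_exists, not_lt] at hy
    simpa [dist_comm] using hy p hp
  calc ε = ε / ρ * ρ := by field_simp
    _ ≤ _ := by gcongr

lemma abs_sub_le_height (hε : 0 ≤ ε) (hρ : 0 ≤ ρ) {t : Set X} (x y : X) :
    |coneBump ε ρ s x - coneBump ε ρ t y| ≤ ε := by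
  have h1 := nonneg (s := s) hε hρ x
  have h2 := nonneg (s := t) hε hρ y
  have h3 := le_height (ε := ε) (ρ := ρ) (s := s) x
  have h4 := le_height (ε := ε) (ρ := ρ) (s := t) y
  exact abs_le.2 ⟨by linarith, by linarith⟩

lemma abs_sub_le_dist (hε : 0 ≤ ε) (hρ : 0 ≤ ρ) (x y : X) :
    |coneBump ε ρ s x - coneBump ε ρ s y| ≤ ε / ρ * dist x y := by
  set K := (⋃ p ∈ s, ball p ρ)ᶜ
  have h : |infDist x K - infDist y K| ≤ dist x y := by
    simpa [Real.dist_eq] using (lipschitz_infDist_pt K).dist_le_mul x y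
  calc |coneBump ε ρ s x - coneBump ε ρ s y|
      ≤ max |ε - ε| |ε / ρ * infDist x K - ε / ρ * infDist y K| := abs_min_sub_min_le_max _ _ _ _
    _ = ε / ρ * |infDist x K - infDist y K| := by
        rw [sub_self, abs_zero, max_eq_right (abs_nonneg _), ← mul_sub, abs_mul,
          abs_of_nonneg (div_nonneg hε hρ)]
    _ ≤ _ := by gcongr

lemma abs_sub_le_rpow (hε : 0 ≤ ε) (hρ : 0 < ρ) {α : ℝ} (h0 : 0 ≤ α) (h1 : α ≤ 1) (x y : X) :
    |coneBump ε ρ s x - coneBump ε ρ s y| ≤ ε * ρ⁻¹ ^ α * dist x y ^ α := by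
  rw [mul_assoc, ← Real.mul_rpow (by positivity) dist_nonneg, inv_mul_eq_div]
  rcases le_total (dist x y / ρ) 1 with h | h
  · refine (abs_sub_le_dist hε hρ.le x y).trans ?_
    rw [div_mul_eq_mul_div, mul_div_assoc]
    gcongr
    exact Real.self_le_rpow_of_le_one (by positivity) h h1
  · refine (abs_sub_le_height hε hρ.le x y).trans ?_
    exact le_mul_of_one_le_right hε (Real.one_le_rpow h h0)

end coneBump

/-- The point of a cubic lattice of mesh `δ` with coordinates `k`. -/
noncomputable def latticePoint {n N : ℕ} (δ : ℝ) (k : Fin n → Fin N) : EuclideanSpace ℝ (Fin n) :=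
  WithLp.toLp 2 fun i ↦ δ * (k i : ℕ)

lemma norm_latticePoint_le {n N : ℕ} {δ : ℝ} (hδ : 0 ≤ δ) (k : Fin n → Fin N) :
    ‖latticePoint δ k‖ ≤ n * (δ * N) := by
  rw [EuclideanSpace.norm_eq]
  refine Real.sqrt_le_iff.2 ⟨by positivity, ?_⟩
  calc ∑ i, ‖latticePoint δ k i‖ ^ 2 ≤ ∑ _i : Fin n, (δ * N) ^ 2 := by
        gcongr with i
        have : ((k i : ℕ) : ℝ) ≤ N := by exact_mod_cast (k i).2.le
        rw [latticePoint, Real.norm_of_nonneg (by positivity)]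
        exact mul_le_mul_of_nonneg_left this hδ
    _ = n * (δ * N) ^ 2 := by simp
    _ ≤ n ^ 2 * (δ * N) ^ 2 := by
        gcongr
        exact_mod_cast Nat.le_self_pow two_ne_zero n
    _ = _ := by ring

lemma le_dist_latticePoint {n N : ℕ} {δ : ℝ} (hδ : 0 ≤ δ) {k l : Fin n → Fin N} (h : k ≠ l) :
    δ ≤ dist (latticePoint δ k) (latticePoint δ l) := by
  obtain ⟨i, hi⟩ := Function.ne_iff.1 h
  have h1 : (1 : ℝ) ≤ |((k i : ℕ) : ℝ) - (l i : ℕ)| := by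
    have : (1 : ℤ) ≤ |((k i : ℕ) : ℤ) - (l i : ℕ)| :=
      Int.one_le_abs (sub_ne_zero.2 (by exact_mod_cast Fin.val_ne_of_ne hi))
    exact_mod_cast this
  calc δ ≤ δ * |((k i : ℕ) : ℝ) - (l i : ℕ)| := le_mul_of_one_le_right hδ h1
    _ = ‖(latticePoint δ k - latticePoint δ l) i‖ := by
        simp [latticePoint, ← mul_sub, abs_of_nonneg hδ]
    _ ≤ _ := by
        rw [dist_eq_norm]
        exact PiLp.norm_apply_le _ i

lemma exists_nat_rpow_le_and_le {α t : ℝ} (hα : 0 < α) (ht : 1 ≤ t) (n : ℕ) :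
    ∃ N : ℕ, 1 ≤ N ∧ (N : ℝ) ^ α ≤ t ∧
      (2 : ℝ) ^ (-((n : ℤ) + 1)) * t ^ ((n : ℝ) / α) ≤ Real.log (2 ^ N ^ n) := by
  have hu : 1 ≤ t ^ α⁻¹ := Real.one_le_rpow ht (by positivity)
  have hN : 1 ≤ ⌊t ^ α⁻¹⌋₊ := Nat.le_floor (by exact_mod_cast hu)
  refine ⟨⌊t ^ α⁻¹⌋₊, hN, ?_, ?_⟩
  · calc ((⌊t ^ α⁻¹⌋₊ : ℕ) : ℝ) ^ α ≤ (t ^ α⁻¹) ^ α := by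
          gcongr
          exact Nat.floor_le (by positivity)
      _ = t := Real.rpow_inv_rpow (by positivity) hα.ne'
  · have hN' : (1 : ℝ) ≤ ⌊t ^ α⁻¹⌋₊ := by exact_mod_cast hN
    have hle : t ^ α⁻¹ / 2 ≤ ⌊t ^ α⁻¹⌋₊ := by
      have := Nat.lt_floor_add_one (t ^ α⁻¹)
      linarith
    have hlog : (1 : ℝ) / 2 ≤ Real.log 2 := by linarith [Real.log_two_gt_d9]
    calc (2 : ℝ) ^ (-((n : ℤ) + 1)) * t ^ ((n : ℝ) / α) = (t ^ α⁻¹ / 2) ^ n * (1 / 2) := by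
          rw [div_pow, ← Real.rpow_mul_natCast (by positivity), inv_mul_eq_div, zpow_neg,
            zpow_add₀ two_ne_zero, zpow_natCast, zpow_one]
          field_simp
      _ ≤ (⌊t ^ α⁻¹⌋₊ : ℝ) ^ n * Real.log 2 := by gcongr
      _ = Real.log (2 ^ ⌊t ^ α⁻¹⌋₊ ^ n) := by rw [Real.log_pow]; push_cast; rfl

/-- Construction of a large ε-discrete subset (w.r.t. the sup distance) of the set
`𝒩^ε_{αβ}(B_{r₀})` of nonnegative potentials supported in the ball of radius `r₀`,
bounded by `ε` in `L^∞` and by `β` in `C^α` norm, with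
`log |Z| ≥ 2^{-(n+1)} (μβ/ε)^{n/α}`. The `C^α` bound `‖q‖_∞ + [q]_α ≤ β` is expressed
via constants `A, B` with `A + B ≤ β` bounding the sup norm and the Hölder seminorm. -/
theorem epsilon_discrete_set_of_potentials (n : ℕ) (hn : 1 ≤ n) (α : ℝ)
    (hα : α ∈ Set.Ioc (0 : ℝ) 1) (r₀ : ℝ) (hr₀ : r₀ ∈ Set.Ioo (0 : ℝ) 1) :
    ∃ μ : ℝ, 0 < μ ∧
      ∀ β : ℝ, 0 < β → ∀ ε : ℝ, 0 < ε → ε < μ * β →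
        ∃ Z : Finset (EuclideanSpace ℝ (Fin n) → ℝ),
          (∀ q ∈ Z, Continuous q ∧ (∀ x, 0 ≤ q x) ∧ (∀ x, r₀ ≤ ‖x‖ → q x = 0) ∧
            (∀ x, |q x| ≤ ε) ∧
            ∃ A B : ℝ, 0 ≤ A ∧ 0 ≤ B ∧ A + B ≤ β ∧ (∀ x, |q x| ≤ A) ∧
              ∀ x y, x ≠ y → |q x - q y| ≤ B * ‖x - y‖ ^ α) ∧
          (∀ q₁ ∈ Z, ∀ q₂ ∈ Z, q₁ ≠ q₂ → ε ≤ ⨆ x, |q₁ x - q₂ x|) ∧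
          (2 : ℝ) ^ (-((n : ℤ) + 1)) * (μ * β / ε) ^ ((n : ℝ) / α) ≤ Real.log Z.card := by
  obtain ⟨hα0, hα1⟩ := hα
  obtain ⟨hr0, hr1⟩ := hr₀
  have hn' : (1 : ℝ) ≤ n := by exact_mod_cast hn
  set d : ℝ := r₀ / (4 * n) with hd
  have hd0 : 0 < d := by positivity
  have hdn : n * (2 * d) + d ≤ r₀ := by
    have : d * (4 * n) = r₀ := div_mul_cancel₀ _ (by positivity)
    nlinarith
  have hd1 : d ≤ 1 := by nlinarith
  refine ⟨d ^ α / 2, by positivity, fun β hβ ε hε hεβ ↦ ?_⟩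
  obtain ⟨N, hN, hNt, hlog⟩ := exists_nat_rpow_le_and_le hα0
    (t := d ^ α / 2 * β / ε) ((one_le_div hε).2 hεβ.le) n
  have hN' : (1 : ℝ) ≤ N := by exact_mod_cast hN
  set ρ : ℝ := d / N with hρ
  have hρ0 : 0 < ρ := by positivity
  have hρd : ρ ≤ d := div_le_self hd0.le hN'
  let P : Finset (Fin n → Fin N) → Set (EuclideanSpace ℝ (Fin n)) :=
    fun S ↦ latticePoint (2 * ρ) '' (S : Set (Fin n → Fin N))
  have hout : ∀ S x, r₀ ≤ ‖x‖ → ∀ p ∈ P S, ρ ≤ dist x p := by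
    rintro S x hx _ ⟨k, -, rfl⟩
    have h1 := norm_latticePoint_le (mul_nonneg zero_le_two hρ0.le) k
    have h2 : 2 * ρ * N = 2 * d := by rw [hρ]; field_simp
    have h3 := norm_sub_norm_le x (latticePoint (2 * ρ) k)
    rw [h2] at h1
    rw [dist_eq_norm]
    linarith
  have hne : ∀ S, (⋃ p ∈ P S, Metric.ball p ρ)ᶜ.Nonempty := fun S ↦
    ⟨EuclideanSpace.single ⟨0, hn⟩ r₀, by
      simpa using hout S _ (by simp [abs_of_pos hr0])⟩
  let f : Finset (Fin n → Fin N) → EuclideanSpace ℝ (Fin n) → ℝ := fun S ↦ coneBump ε ρ (P S)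
  have hin : ∀ S, ∀ k ∈ S, f S (latticePoint (2 * ρ) k) = ε := fun S k hk ↦
    coneBump.eq_height hε.le hρ0 (hne S) ⟨k, hk, rfl⟩
  have hnotin : ∀ S, ∀ k ∉ S, f S (latticePoint (2 * ρ) k) = 0 := by
    intro S k hk
    refine coneBump.eq_zero hε.le ?_
    rintro _ ⟨l, hl, rfl⟩
    have hkl : k ≠ l := fun h ↦ hk (h ▸ hl)
    linarith [le_dist_latticePoint (mul_nonneg zero_le_two hρ0.le) hkl]
  have hsep : ∀ S T, S ≠ T → ∃ x, |f S x - f T x| = ε := by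
    intro S T hST
    obtain ⟨k, hk⟩ : ∃ k, ¬(k ∈ S ↔ k ∈ T) := by
      by_contra! h
      exact hST (Finset.ext h)
    refine ⟨latticePoint (2 * ρ) k, ?_⟩
    by_cases hkS : k ∈ S <;> by_cases hkT : k ∈ T
    · tauto
    · rw [hin S k hkS, hnotin T k hkT, sub_zero, abs_of_pos hε]
    · rw [hin T k hkT, hnotin S k hkS, zero_sub, abs_neg, abs_of_pos hε]
    · tauto
  have hinj : Function.Injective f := by
    intro S T h
    by_contra hST
    obtain ⟨x, hx⟩ := hsep S T hST
    rw [h, sub_self, abs_zero] at hx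
    exact hε.ne hx
  have hbound : ε + ε * ρ⁻¹ ^ α ≤ β := by
    have h1 : 1 ≤ ρ⁻¹ ^ α :=
      Real.one_le_rpow ((one_le_inv₀ hρ0).2 (hρd.trans hd1)) hα0.le
    have h2 : ρ⁻¹ ^ α = (N : ℝ) ^ α / d ^ α := by
      rw [hρ, inv_div, Real.div_rpow (by positivity) hd0.le]
    have h3 : ρ⁻¹ ^ α ≤ β / (2 * ε) := by
      rw [h2, div_le_iff₀ (by positivity)]
      refine hNt.trans_eq ?_
      field_simp
    calc ε + ε * ρ⁻¹ ^ α ≤ ε * ρ⁻¹ ^ α + ε * ρ⁻¹ ^ α := by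
          gcongr
          exact le_mul_of_one_le_right hε.le h1
      _ = 2 * ε * ρ⁻¹ ^ α := by ring
      _ ≤ 2 * ε * (β / (2 * ε)) := by gcongr
      _ = β := by field_simp
  have habs : ∀ S x, |f S x| ≤ ε := fun S x ↦ by
    rw [abs_of_nonneg (coneBump.nonneg hε.le hρ0.le x)]
    exact coneBump.le_height x
  refine ⟨Finset.univ.map ⟨f, hinj⟩, ?_, ?_, ?_⟩
  · simp only [Finset.mem_map, Finset.mem_univ, true_and, Function.Embedding.coeFn_mk,
      forall_exists_index, forall_apply_eq_imp_iff]
    refine fun S ↦ ⟨coneBump.continuous, coneBump.nonneg hε.le hρ0.le,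
      fun x hx ↦ coneBump.eq_zero hε.le (hout S x hx), habs S, ε, ε * ρ⁻¹ ^ α, hε.le,
      by positivity, hbound, habs S, fun x y _ ↦ ?_⟩
    rw [← dist_eq_norm]
    exact coneBump.abs_sub_le_rpow hε.le hρ0 hα0.le hα1 x y
  · simp only [Finset.mem_map, Finset.mem_univ, true_and, Function.Embedding.coeFn_mk,
      forall_exists_index, forall_apply_eq_imp_iff]
    intro S T hST
    obtain ⟨x, hx⟩ := hsep S T fun h ↦ hST (congrArg f h)
    refine le_ciSup_of_le ⟨ε, ?_⟩ x hx.ge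
    rintro _ ⟨y, rfl⟩
    exact coneBump.abs_sub_le_height hε.le hρ0.le y y
  · simpa using hlog
end

section
/- Let s ∈ (0,1), let k ≥ 0 be an integer, and let g : (2,3) → ℝ be an integrable function such that ∫_2^3 r^{−j} g(r) dr = 0 for all integers 0 ≤ j ≤ k−1 and |∫_2^3 r^{−j} g(r) dr| ≤ 2^{−(1+j)} for all integers j ≥ k. Then for every x ∈ (−1,1): |(1 − x²)^s · ∫_2^3 (r g(r))/(r − x) dr| ≤ 2^{−k}. -/
open MeasureTheory

/-- The geometric expansion of the kernel `r / (r - x)` may be integrated term by term against an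
integrable function on `(2,3)`. -/
theorem hasSum_integral_geometric_kernel {g : ℝ → ℝ} (hg : IntegrableOn g (Set.Ioo 2 3))
    {x : ℝ} (hx : |x| < 1) :
    HasSum (fun j : ℕ => x ^ j * ∫ r in Set.Ioo (2 : ℝ) 3, r ^ (-(j : ℝ)) * g r)
      (∫ r in Set.Ioo (2 : ℝ) 3, r * g r / (r - x)) := by
  have ratio_le : ∀ r ∈ Set.Ioo (2 : ℝ) 3, |x / r| ≤ 1 / 2 := by
    rintro r ⟨h2, -⟩
    rw [abs_div, abs_of_pos (by linarith : 0 < r), div_le_div_iff₀ (by linarith) two_pos]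
    linarith
  have term_le : ∀ j : ℕ, ∀ᵐ r ∂volume.restrict (Set.Ioo (2 : ℝ) 3),
      ‖(x / r) ^ j * g r‖ ≤ (1 / 2) ^ j * ‖g r‖ := by
    intro j
    filter_upwards [ae_restrict_mem measurableSet_Ioo] with r hr
    rw [norm_mul, norm_pow, Real.norm_eq_abs (x / r)]
    gcongr
    exact ratio_le r hr
  have term_int : ∀ j : ℕ, IntegrableOn (fun r => (x / r) ^ j * g r) (Set.Ioo 2 3) := fun j =>
    (hg.norm.const_mul ((1 / 2 : ℝ) ^ j)).mono'
      (AEStronglyMeasurable.mul (by fun_prop) hg.aestronglyMeasurable) (term_le j)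
  have summable_norm :
      Summable fun j : ℕ => ∫ r in Set.Ioo (2 : ℝ) 3, ‖(x / r) ^ j * g r‖ := by
    refine Summable.of_nonneg_of_le (fun j => integral_nonneg fun r => norm_nonneg _) (fun j => ?_)
      (summable_geometric_two.mul_right (∫ r in Set.Ioo (2 : ℝ) 3, ‖g r‖))
    rw [← integral_const_mul]
    exact integral_mono_ae (term_int j).norm (hg.norm.const_mul _) (term_le j)
  have term_eq : ∀ j : ℕ, x ^ j * ∫ r in Set.Ioo (2 : ℝ) 3, r ^ (-(j : ℝ)) * g r =
      ∫ r in Set.Ioo (2 : ℝ) 3, (x / r) ^ j * g r := by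
    intro j
    rw [← integral_const_mul]
    refine setIntegral_congr_fun measurableSet_Ioo fun r hr => ?_
    have hr0 : 0 ≤ r := by linarith [hr.1]
    simp only [Real.rpow_neg hr0, Real.rpow_natCast, div_pow]
    ring
  have sum_eq : ∫ r in Set.Ioo (2 : ℝ) 3, r * g r / (r - x) =
      ∫ r in Set.Ioo (2 : ℝ) 3, ∑' j : ℕ, (x / r) ^ j * g r := by
    refine setIntegral_congr_fun measurableSet_Ioo fun r hr => ?_
    have hr0 : r ≠ 0 := (two_pos.trans hr.1).ne'
    have hlt : |x / r| < 1 := (ratio_le r hr).trans_lt (by norm_num)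
    simp only [tsum_mul_right, tsum_geometric_of_abs_lt_one hlt]
    rw [one_sub_div hr0, inv_div]
    ring
  simp only [term_eq, sum_eq]
  exact hasSum_integral_of_summable_integral_norm term_int summable_norm

/-- One-dimensional decay bound via moments: if `g` is integrable on `(2,3)`, its moments
`∫_2^3 r^{-j} g dr` vanish for `j < k` and are bounded by `2^{-(1+j)}` for `j ≥ k`, then
for every `x ∈ (-1,1)`, `|(1-x²)^s ∫_2^3 r g(r)/(r-x) dr| ≤ 2^{-k}`. -/
theorem one_dim_poisson_decay (s : ℝ) (hs : s ∈ Set.Ioo (0 : ℝ) 1) (k : ℕ)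
    (g : ℝ → ℝ) (hg : IntegrableOn g (Set.Ioo 2 3))
    (hmom0 : ∀ j : ℕ, j < k → (∫ r in Set.Ioo (2 : ℝ) 3, r ^ (-(j : ℝ)) * g r) = 0)
    (hmom : ∀ j : ℕ, k ≤ j →
      |∫ r in Set.Ioo (2 : ℝ) 3, r ^ (-(j : ℝ)) * g r| ≤ 2 ^ (-(1 + (j : ℝ)))) :
    ∀ x ∈ Set.Ioo (-1 : ℝ) 1,
      |(1 - x ^ 2) ^ s * ∫ r in Set.Ioo (2 : ℝ) 3, r * g r / (r - x)| ≤ 2 ^ (-(k : ℝ)) := by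
  intro x hx
  have hx1 : |x| < 1 := abs_lt.mpr hx
  have hsum := (hasSum_nat_add_iff' k).mpr (hasSum_integral_geometric_kernel hg hx1)
  rw [Finset.sum_eq_zero fun j hj => by rw [hmom0 j (Finset.mem_range.mp hj), mul_zero],
    sub_zero] at hsum
  have hI : |∫ r in Set.Ioo (2 : ℝ) 3, r * g r / (r - x)| ≤ 2 ^ (-(k : ℝ)) := by
    rw [← hsum.tsum_eq]
    have hgeom : HasSum (fun j : ℕ => (2 : ℝ) ^ (-(k : ℝ)) / 2 / 2 ^ j) (2 ^ (-(k : ℝ))) :=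
      hasSum_geometric_two' _
    rw [← Real.norm_eq_abs]
    refine tsum_of_norm_bounded hgeom fun j => ?_
    rw [norm_mul, norm_pow, Real.norm_eq_abs, Real.norm_eq_abs]
    refine (mul_le_of_le_one_left (abs_nonneg _)
      (pow_le_one₀ (abs_nonneg x) hx1.le)).trans ((hmom (j + k) (by omega)).trans_eq ?_)
    rw [show -(1 + ((j + k : ℕ) : ℝ)) = -(k : ℝ) - 1 - j by push_cast; ring,
      Real.rpow_sub two_pos, Real.rpow_sub two_pos, Real.rpow_one, Real.rpow_natCast]
  have hsq : x ^ 2 ≤ 1 := (sq_le_one_iff_abs_le_one x).mpr hx1.le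
  have hbase : 0 ≤ 1 - x ^ 2 := by linarith
  rw [abs_mul, abs_of_nonneg (Real.rpow_nonneg hbase s)]
  exact (mul_le_of_le_one_left (abs_nonneg _)
    (Real.rpow_le_one hbase (by linarith [sq_nonneg x]) hs.1.le)).trans hI
end

section
/- Let c > 0. There exist constants K > 0 and K' > 1 (depending only on c) such that: for every C₁ ≥ 1 and every δ with 0 < δ < C₁, there is a finite set Y of functions ℕ × ℕ → ℝ with the following two properties: (i) for every a : ℕ × ℕ → ℝ satisfying |a(k₁,k₂)| ≤ C₁ e^{−c·max(k₁,k₂)} for all k₁, k₂ ∈ ℕ, there exists b ∈ Y with sup_{k₁,k₂} (1 + max(k₁,k₂))³ |a(k₁,k₂) − b(k₁,k₂)| ≤ δ; and (ii) log |Y| ≤ K · (log(K' C₁ / δ))³. -/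
/-- A cubic weight is dominated by any exponential. -/
theorem exists_one_add_cube_le_mul_exp {c : ℝ} (hc : 0 < c) :
    ∃ B : ℝ, Real.exp 1 ≤ B ∧
      ∀ m : ℕ, (1 + (m : ℝ)) ^ 3 ≤ B * Real.exp (c * m) := by
  have h0 : 0 ≤ 6 * Real.exp c / c ^ 3 := by positivity
  refine ⟨6 * Real.exp c / c ^ 3 + Real.exp 1, by linarith, fun m => ?_⟩
  have h := Real.pow_div_factorial_le_exp (c * (1 + m)) (by positivity) 3
  have hexp : Real.exp (c * (1 + m)) = Real.exp c * Real.exp (c * m) := by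
    rw [← Real.exp_add]; ring_nf
  rw [hexp, div_le_iff₀ (by positivity), mul_pow] at h
  norm_num [Nat.factorial] at h
  calc (1 + (m : ℝ)) ^ 3 ≤ 6 * Real.exp c / c ^ 3 * Real.exp (c * m) := by
        rw [div_mul_eq_mul_div, le_div_iff₀ (by positivity)]
        linarith
    _ ≤ _ := by gcongr; linarith [Real.exp_pos 1]

/-- Functions on `ℕ × ℕ` that are bounded by `h * M` admit, for uniform approximation within `h`
on the square `[0, N)²`, a net of functions vanishing outside that square with at most
`(2 * M + 1) ^ (N * N)` elements. -/
theorem exists_grid_net (N M : ℕ) {h : ℝ} (hh : 0 < h) :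
    ∃ Y : Finset (ℕ → ℕ → ℝ), Y.card ≤ (2 * M + 1) ^ (N * N) ∧ Y.Nonempty ∧
      ∀ a : ℕ → ℕ → ℝ, (∀ i j, |a i j| ≤ h * M) →
        ∃ b ∈ Y, ∀ i j, (max i j < N → |a i j - b i j| ≤ h) ∧ (N ≤ max i j → b i j = 0) := by
  classical
  let S : Finset (Fin N × Fin N → ℤ) :=
    Fintype.piFinset fun _ => Finset.Icc (-(M : ℤ)) M
  let F : (Fin N × Fin N → ℤ) → ℕ → ℕ → ℝ := fun g i j =>
    if hij : i < N ∧ j < N then h * g (⟨i, hij.1⟩, ⟨j, hij.2⟩) else 0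
  refine ⟨S.image F, ?_, ?_, fun a ha => ?_⟩
  · refine Finset.card_image_le.trans (le_of_eq ?_)
    simp only [S, Fintype.card_piFinset, Int.card_Icc, Finset.prod_const, Finset.card_univ,
      Fintype.card_prod, Fintype.card_fin]
    congr 1
    omega
  · exact ⟨F 0, Finset.mem_image_of_mem F (by simp [S])⟩
  · let g : Fin N × Fin N → ℤ := fun p => ⌊a p.1 p.2 / h⌋
    refine ⟨F g, Finset.mem_image_of_mem F ?_, fun i j => ⟨fun hij => ?_, fun hij => ?_⟩⟩
    · simp only [S, g, Fintype.mem_piFinset, Finset.mem_Icc]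
      intro p
      obtain ⟨h1, h2⟩ := abs_le.mp (ha p.1 p.2)
      constructor
      · rw [Int.le_floor, le_div_iff₀ hh]
        push_cast
        linarith
      · have : (⌊a p.1 p.2 / h⌋ : ℝ) ≤ M :=
          (Int.floor_le _).trans ((div_le_iff₀ hh).mpr (by linarith))
        exact_mod_cast this
    · simp only [F, g, dif_pos (max_lt_iff.mp hij)]
      have h1 := (le_div_iff₀ hh).mp (Int.floor_le (a i j / h))
      have h2 := (div_lt_iff₀ hh).mp (Int.lt_floor_add_one (a i j / h))
      rw [abs_le]
      constructor <;> linarith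
    · exact dif_neg fun hlt => by omega

/-- One-dimensional δ-net (metric entropy) estimate: the tensors `a : ℕ × ℕ → ℝ` with
entrywise decay `|a(k₁,k₂)| ≤ C₁ e^{-c max(k₁,k₂)}` admit a finite δ-net `Y` for the
weighted sup norm `sup (1+max(k₁,k₂))³ |a - b|`, with
`log |Y| ≤ K (log (K' C₁/δ))³`, where `K > 0` and `K' > 1` depend only on `c`. -/
theorem one_dim_delta_net_for_decaying_tensors (c : ℝ) (hc : 0 < c) :
    ∃ K K' : ℝ, 0 < K ∧ 1 < K' ∧
      ∀ C₁ δ : ℝ, 1 ≤ C₁ → 0 < δ → δ < C₁ →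
        ∃ Y : Finset (ℕ → ℕ → ℝ),
          (∀ a : ℕ → ℕ → ℝ,
            (∀ k₁ k₂ : ℕ, |a k₁ k₂| ≤ C₁ * Real.exp (-c * ((max k₁ k₂ : ℕ) : ℝ))) →
            ∃ b ∈ Y, ∀ k₁ k₂ : ℕ,
              ((1 : ℝ) + (max k₁ k₂ : ℕ)) ^ 3 * |a k₁ k₂ - b k₁ k₂| ≤ δ) ∧
          Real.log Y.card ≤ K * (Real.log (K' * C₁ / δ)) ^ 3 := by
  obtain ⟨B, hB, hcube⟩ := exists_one_add_cube_le_mul_exp (half_pos hc)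
  have hB1 : 1 < B := lt_of_lt_of_le (by linarith [Real.add_one_lt_exp one_ne_zero]) hB
  set A : ℝ := 2 / c + 1 with hA
  have hA0 : 0 < A := by positivity
  refine ⟨A ^ 2 * (3 + 3 * A), B, by positivity, hB1, fun C₁ δ hC hδ hδC => ?_⟩
  have hC0 : 0 < C₁ := by linarith
  have hR : 1 < C₁ / δ := (one_lt_div hδ).mpr hδC
  set R := C₁ / δ with hRdef
  rw [mul_div_assoc, ← hRdef]
  have hC_eq : C₁ = R * δ := by rw [hRdef]; field_simp
  have hLsum : Real.log (B * R) = Real.log B + Real.log R :=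
    Real.log_mul (by positivity) (by positivity)
  have hlogB : 1 ≤ Real.log B := (Real.le_log_iff_exp_le (by positivity)).mpr hB
  have hlogR : 0 < Real.log R := Real.log_pos hR
  have hBR : Real.exp (Real.log (B * R)) = B * R := Real.exp_log (by positivity)
  set L := Real.log (B * R)
  have hL1 : 1 ≤ L := by linarith
  set N := ⌈2 / c * L⌉₊
  have hN : 2 / c * L ≤ N := Nat.le_ceil _
  have hNA : (N : ℝ) ≤ A * L := by
    have : (N : ℝ) < 2 / c * L + 1 := Nat.ceil_lt_add_one (by positivity)
    rw [hA]; linarith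
  set M := ⌈R * (1 + N) ^ 3⌉₊
  have hM : R * (1 + N) ^ 3 ≤ M := Nat.le_ceil _
  have hM' : (M : ℝ) < R * (1 + N) ^ 3 + 1 := Nat.ceil_lt_add_one (by positivity)
  obtain ⟨Y, hcard, hYne, hY⟩ :=
    exists_grid_net N M (show 0 < δ / (1 + (N : ℝ)) ^ 3 by positivity)
  refine ⟨Y, fun a ha => ?_, ?_⟩
  · obtain ⟨b, hbY, hb⟩ := hY a fun i j => by
      calc |a i j| ≤ C₁ * Real.exp (-c * ((max i j : ℕ) : ℝ)) := ha i j
        _ ≤ C₁ * 1 := by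
          gcongr
          refine Real.exp_le_one_iff.mpr ?_
          rw [neg_mul, neg_nonpos]
          positivity
        _ = δ / (1 + (N : ℝ)) ^ 3 * (R * (1 + N) ^ 3) := by rw [hC_eq]; field_simp
        _ ≤ _ := by gcongr
    refine ⟨b, hbY, fun i j => ?_⟩
    have ha' := ha i j
    obtain ⟨hb1, hb2⟩ := hb i j
    generalize max i j = m at *
    rcases lt_or_ge m N with hm | hm
    · calc ((1 : ℝ) + m) ^ 3 * |a i j - b i j|
          ≤ (1 + N) ^ 3 * (δ / (1 + (N : ℝ)) ^ 3) := by
            gcongr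
            exact hb1 hm
        _ = δ := by field_simp
    · rw [hb2 hm, sub_zero]
      have hLm : L ≤ c / 2 * m := by
        have : 2 / c * L ≤ m := hN.trans (by exact_mod_cast hm)
        calc L = c / 2 * (2 / c * L) := by field_simp
          _ ≤ _ := by gcongr
      calc ((1 : ℝ) + m) ^ 3 * |a i j|
          ≤ (B * Real.exp (c / 2 * m)) * (C₁ * Real.exp (-c * m)) := by
            gcongr
            exact hcube m
        _ = B * C₁ * Real.exp (-(c / 2 * m)) := by
            rw [mul_mul_mul_comm, ← Real.exp_add]
            ring_nf
        _ ≤ B * C₁ * Real.exp (-L) := by gcongr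
        _ = δ := by
            rw [Real.exp_neg, hBR, hC_eq]
            field_simp
  · have hlog : Real.log (2 * M + 1) ≤ 2 + L + 3 * N := by
      have h1 : 1 ≤ R * (1 + (N : ℝ)) ^ 3 :=
        one_le_mul_of_one_le_of_one_le hR.le (one_le_pow₀ (by simp))
      have h5 : (5 : ℝ) ≤ Real.exp 2 := by
        have := Real.quadratic_le_exp_of_nonneg (show (0 : ℝ) ≤ 2 by norm_num)
        linarith
      have hN3 : (1 + (N : ℝ)) ^ 3 ≤ Real.exp (3 * N) := by
        rw [show (3 : ℝ) * N = (3 : ℕ) * (N : ℝ) by norm_num, Real.exp_nat_mul]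
        gcongr
        linarith [Real.add_one_le_exp (N : ℝ)]
      have hRL : R ≤ Real.exp L := by
        rw [hBR]
        exact le_mul_of_one_le_left (by positivity) hB1.le
      rw [Real.log_le_iff_le_exp (by positivity), Real.exp_add, Real.exp_add]
      calc 2 * (M : ℝ) + 1 ≤ 5 * R * (1 + N) ^ 3 := by linarith
        _ ≤ _ := by gcongr
    calc Real.log Y.card ≤ Real.log ((2 * M + 1) ^ (N * N)) :=
          Real.log_le_log (by exact_mod_cast hYne.card_pos) (by exact_mod_cast hcard)
      _ = (N : ℝ) ^ 2 * Real.log (2 * M + 1) := by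
          rw [Real.log_pow]
          push_cast
          ring
      _ ≤ (A * L) ^ 2 * (2 * L + L + 3 * (A * L)) := by
          gcongr
          · exact Real.log_nonneg (by linarith [Nat.cast_nonneg (α := ℝ) M])
          · linarith
      _ = A ^ 2 * (3 + 3 * A) * L ^ 3 := by ring
end
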